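/- There do not exist an open interval I ⊆ ℝ, smooth functions x, y, r : I → ℝ with r > 0 on I, and real numbers A₁, A₀, B₁, B₀ such that the vectors P = (A₁, B₁) and Q = (A₀, B₀) are linearly dependent with (P, Q) ≠ ((0,0),(0,0)), and such that on I: x'' = (A₁τ + A₀)·r², y'' = (B₁τ + B₀)·r², r'' = r, and x'² + y'² + r'² = r². -/

import Mathlib

open Set

lemma aux_hasDerivAt {lo hi : ℝ} {f : ℝ → ℝ} (hf : ContDiffOn ℝ (⊤ : ℕ∞) f (Ioo lo hi))
    {t : ℝ} (ht : t ∈ Ioo lo hi) :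
    HasDerivAt f (deriv f t) t ∧ HasDerivAt (deriv f) (deriv (deriv f) t) t := by
  have h2 : ContDiffOn ℝ 1 (deriv f) (Ioo lo hi) :=
    ((contDiffOn_infty_iff_deriv_of_isOpen isOpen_Ioo).1 hf).2.of_le (by exact_mod_cast le_top)
  have hn := isOpen_Ioo.mem_nhds ht
  exact ⟨((hf.differentiableOn (by simp)).differentiableAt hn).hasDerivAt,
    ((h2.differentiableOn (by simp)).differentiableAt hn).hasDerivAt⟩

lemma aux_zero {lo hi : ℝ} {g : ℝ → ℝ} (hg : ∀ s ∈ Ioo lo hi, g s = 0)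
    {t d : ℝ} (ht : t ∈ Ioo lo hi) (h : HasDerivAt g d t) : d = 0 := by
  have e : g =ᶠ[nhds t] fun _ => (0 : ℝ) := by
    filter_upwards [isOpen_Ioo.mem_nhds ht] with s hs using hg s hs
  exact h.unique ((hasDerivAt_const t (0 : ℝ)).congr_of_eventuallyEq e)

/-- Exclusion of Case (II): `c ≡ 0`, `P = (A₁, B₁)` and `Q = (A₀, B₀)`
linearly dependent (i.e., `det(P,Q) = 0`) but not both zero, is impossible. -/
theorem case_II_cannot_occur :
    ¬ ∃ (lo hi : ℝ) (x y r : ℝ → ℝ) (A₁ A₀ B₁ B₀ : ℝ),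
      lo < hi ∧
      ContDiffOn ℝ (⊤ : ℕ∞) x (Ioo lo hi) ∧
      ContDiffOn ℝ (⊤ : ℕ∞) y (Ioo lo hi) ∧
      ContDiffOn ℝ (⊤ : ℕ∞) r (Ioo lo hi) ∧
      (∀ τ ∈ Ioo lo hi, 0 < r τ) ∧
      A₁ * B₀ - B₁ * A₀ = 0 ∧
      ¬ (A₁ = 0 ∧ B₁ = 0 ∧ A₀ = 0 ∧ B₀ = 0) ∧
      (∀ τ ∈ Ioo lo hi, deriv (deriv x) τ = (A₁ * τ + A₀) * r τ ^ 2) ∧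
      (∀ τ ∈ Ioo lo hi, deriv (deriv y) τ = (B₁ * τ + B₀) * r τ ^ 2) ∧
      (∀ τ ∈ Ioo lo hi, deriv (deriv r) τ = r τ) ∧
      (∀ τ ∈ Ioo lo hi,
        deriv x τ ^ 2 + deriv y τ ^ 2 + deriv r τ ^ 2 = r τ ^ 2) := by
  rintro ⟨lo, hi, x, y, r, A₁, A₀, B₁, B₀, hlt, hx, hy, hr, hpos, hdet, hne, ex, ey, er, harc⟩
  have h1 : ∀ t ∈ Ioo lo hi,
      (A₁ * t + A₀) * deriv x t + (B₁ * t + B₀) * deriv y t = 0 := by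
    intro t ht
    have hu := (aux_hasDerivAt hx ht).2
    have hv := (aux_hasDerivAt hy ht).2
    obtain ⟨hr0, hr1⟩ := aux_hasDerivAt hr ht
    rw [ex t ht] at hu
    rw [ey t ht] at hv
    rw [er t ht] at hr1
    have hd := (((hu.mul hu).add (hv.mul hv)).add (hr1.mul hr1)).sub (hr0.mul hr0)
    have h0 := aux_zero (fun s hs => by
      have := harc s hs
      simp only [Pi.sub_apply, Pi.add_apply, Pi.mul_apply]
      linarith) ht hd
    have hp := pow_pos (hpos t ht) 2
    have : r t ^ 2 * ((A₁ * t + A₀) * deriv x t + (B₁ * t + B₀) * deriv y t) = 0 := by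
      linarith
    exact (mul_eq_zero.1 this).resolve_left hp.ne'
  have h2 : ∀ t ∈ Ioo lo hi, A₁ * t + A₀ = 0 ∧ B₁ * t + B₀ = 0 := by
    intro t ht
    have hu := (aux_hasDerivAt hx ht).2
    have hv := (aux_hasDerivAt hy ht).2
    rw [ex t ht] at hu
    rw [ey t ht] at hv
    have ha : HasDerivAt (fun s : ℝ => A₁ * s + A₀) A₁ t := by
      simpa using ((hasDerivAt_id t).const_mul A₁).add_const A₀
    have hb : HasDerivAt (fun s : ℝ => B₁ * s + B₀) B₁ t := by
      simpa using ((hasDerivAt_id t).const_mul B₁).add_const B₀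
    have h0 := aux_zero (fun s hs => by
      simpa using h1 s hs) ht ((ha.mul hu).add (hb.mul hv))
    have h3 := h1 t ht
    have hp := pow_pos (hpos t ht) 2
    have hpar : (A₁ * t + A₀) * B₁ = (B₁ * t + B₀) * A₁ := by linarith
    generalize A₁ * t + A₀ = a at *
    generalize B₁ * t + B₀ = b at *
    generalize deriv x t = u at *
    generalize deriv y t = v at *
    have ka : a * (u * A₁ + v * B₁) = 0 := by linear_combination A₁ * h3 + v * hpar
    have kb : b * (u * A₁ + v * B₁) = 0 := by linear_combination B₁ * h3 - u * hpar
    have hs : u * A₁ + v * B₁ + (a ^ 2 + b ^ 2) * r t ^ 2 = 0 := by linarith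
    have qa : a * ((a ^ 2 + b ^ 2) * r t ^ 2) = 0 := by linear_combination a * hs - ka
    have qb : b * ((a ^ 2 + b ^ 2) * r t ^ 2) = 0 := by linear_combination b * hs - kb
    have q : (a ^ 2 + b ^ 2) = 0 := by
      have : (a ^ 2 + b ^ 2) ^ 2 * r t ^ 2 = 0 := by linear_combination a * qa + b * qb
      exact pow_eq_zero_iff (two_ne_zero) |>.1 ((mul_eq_zero.1 this).resolve_right hp.ne')
    constructor <;> nlinarith [sq_nonneg a, sq_nonneg b]
  obtain ⟨s, hs1, hs2⟩ := exists_between hlt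
  obtain ⟨t, ht1, ht2⟩ := exists_between hs2
  obtain ⟨a1, b1⟩ := h2 s ⟨hs1, hs2⟩
  obtain ⟨a2, b2⟩ := h2 t ⟨hs1.trans ht1, ht2⟩
  have hts : t - s ≠ 0 := (sub_pos.2 ht1).ne'
  have eA : A₁ = 0 := (mul_eq_zero.1 (by linear_combination a2 - a1 : A₁ * (t - s) = 0)).resolve_right hts
  have eB : B₁ = 0 := (mul_eq_zero.1 (by linear_combination b2 - b1 : B₁ * (t - s) = 0)).resolve_right hts
  subst eA eB
  exact hne ⟨rfl, rfl, by linarith, by linarith⟩
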